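/- arXiv:2405.15399 — 9 statements merged into one kernel-verified Lean document; each statement's English description precedes it below -/
import Mathlib

section
/- Let p, q, s be nonempty finite index types, let A : Matrix q p ℝ, T : Matrix p s ℝ, and set Γ = T * Tᵀ. Then a matrix Λ : Matrix q p ℝ satisfies the kriging equation A * Γ * Aᵀ * Λ = A * Γ if and only if Λ minimizes the functional Λ' ↦ trace((Λ'ᵀ * A - 1) * Γ * (Λ'ᵀ * A - 1)ᵀ) over all Λ' : Matrix q p ℝ, i.e. for every Λ' : Matrix q p ℝ one has trace((Λᵀ * A - 1) * Γ * (Λᵀ * A - 1)ᵀ) ≤ trace((Λ'ᵀ * A - 1) * Γ * (Λ'ᵀ * A - 1)ᵀ). -/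
open Matrix

lemma kriging_expand
    {p q : Type*} [Fintype p] [Fintype q] [DecidableEq p]
    (A : Matrix q p ℝ) (Γ : Matrix p p ℝ) (hΓ : Γᵀ = Γ)
    (Λ H : Matrix q p ℝ) (t : ℝ) :
    (((Λ + t • H)ᵀ * A - 1) * Γ * ((Λ + t • H)ᵀ * A - 1)ᵀ).trace =
      ((Λᵀ * A - 1) * Γ * (Λᵀ * A - 1)ᵀ).trace
        + 2 * t * (Hᵀ * (A * Γ * Aᵀ * Λ - A * Γ)).trace
        + t ^ 2 * (Hᵀ * (A * Γ * Aᵀ) * H).trace := by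
  have h1 : Hᵀ * (A * Γ * Aᵀ * Λ - A * Γ) = (Hᵀ * A) * Γ * (Λᵀ * A - 1)ᵀ := by
    simp [Matrix.mul_sub, Matrix.mul_assoc]
  have h2 : ((Λᵀ * A - 1) * Γ * (Hᵀ * A)ᵀ).trace
      = ((Hᵀ * A) * Γ * (Λᵀ * A - 1)ᵀ).trace := by
    generalize Λᵀ * A - 1 = M
    generalize Hᵀ * A = N
    rw [← Matrix.trace_transpose, Matrix.transpose_mul, Matrix.transpose_mul, hΓ,
      Matrix.transpose_transpose, Matrix.mul_assoc]
  have h3 : Hᵀ * (A * Γ * Aᵀ) * H = (Hᵀ * A) * Γ * (Hᵀ * A)ᵀ := by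
    simp [Matrix.mul_assoc]
  have h4 : (Λ + t • H)ᵀ * A - 1 = (Λᵀ * A - 1) + t • (Hᵀ * A) := by
    simp [Matrix.add_mul]; abel
  rw [h1, h3, h4]
  generalize Λᵀ * A - 1 = M at *
  generalize Hᵀ * A = N at *
  simp only [Matrix.transpose_add, Matrix.transpose_smul, Matrix.add_mul, Matrix.mul_add,
    Matrix.smul_mul, Matrix.mul_smul, Matrix.trace_add, Matrix.trace_smul, smul_eq_mul, h2]
  ring

/-- Variational characterization of the kriging equation: for `Γ = T * Tᵀ`,
`Λ` satisfies `A * Γ * Aᵀ * Λ = A * Γ` iff `Λ` minimizes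
`Λ' ↦ trace((Λ'ᵀ * A - 1) * Γ * (Λ'ᵀ * A - 1)ᵀ)`. -/
theorem kriging_equation_iff_minimizer
    {p q s : Type*} [Fintype p] [Fintype q] [Fintype s]
    [Nonempty p] [Nonempty q] [Nonempty s] [DecidableEq p]
    (A : Matrix q p ℝ) (T : Matrix p s ℝ) (Γ : Matrix p p ℝ) (hΓ : Γ = T * Tᵀ)
    (Λ : Matrix q p ℝ) :
    A * Γ * Aᵀ * Λ = A * Γ ↔
      ∀ Λ' : Matrix q p ℝ,
        ((Λᵀ * A - 1) * Γ * (Λᵀ * A - 1)ᵀ).trace ≤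
          ((Λ'ᵀ * A - 1) * Γ * (Λ'ᵀ * A - 1)ᵀ).trace := by
  have hsym : Γᵀ = Γ := by simp [hΓ]
  have hpos : ∀ H : Matrix q p ℝ, 0 ≤ (Hᵀ * (A * Γ * Aᵀ) * H).trace := by
    intro H
    have : Hᵀ * (A * Γ * Aᵀ) * H = (Hᵀ * A * T) * (Hᵀ * A * T)ᵀ := by
      simp [hΓ, Matrix.mul_assoc]
    rw [this]
    simp only [Matrix.trace, Matrix.diag_apply, Matrix.mul_apply, Matrix.transpose_apply]
    exact Finset.sum_nonneg fun i _ => Finset.sum_nonneg fun j _ => mul_self_nonneg _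
  constructor
  · intro h Λ'
    have e := kriging_expand A Γ hsym Λ (Λ' - Λ) 1
    have h0 := hpos (Λ' - Λ)
    rw [h, sub_self, Matrix.mul_zero, Matrix.trace_zero, one_smul, add_sub_cancel] at e
    rw [e]
    linarith
  · intro h
    rw [← sub_eq_zero]
    set G := A * Γ * Aᵀ * Λ - A * Γ with hG
    have hc := hpos G
    set c := (Gᵀ * (A * Γ * Aᵀ) * G).trace with hcdef
    have key : ∀ t : ℝ, 0 ≤ 2 * t * (Gᵀ * G).trace + t ^ 2 * c := by
      intro t
      have e := kriging_expand A Γ hsym Λ G t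
      have := h (Λ + t • G)
      rw [e] at this
      linarith
    have hg : (Gᵀ * G).trace = 0 := by
      generalize (Gᵀ * G).trace = g at key
      have k := key (-g / (c + 1))
      have hc1 : 0 < c + 1 := by linarith
      have e : 2 * (-g / (c + 1)) * g + (-g / (c + 1)) ^ 2 * c
          = -(g ^ 2 * (c + 2)) / (c + 1) ^ 2 := by
        field_simp; ring
      rw [e, le_div_iff₀ (by positivity), zero_mul] at k
      have : g ^ 2 ≤ 0 := by nlinarith [sq_nonneg g, mul_nonneg (sq_nonneg g) hc]
      exact pow_eq_zero_iff (two_ne_zero) |>.1 (le_antisymm this (sq_nonneg g))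
    rw [← Matrix.conjTranspose_eq_transpose_of_trivial] at hg
    exact Matrix.trace_conjTranspose_mul_self_eq_zero_iff.1 hg
end

section
/- Let ι, κ₁, κ₂ be nonempty finite index types, let μ = Measure.pi (fun _ : ι => gaussianReal 0 1) be the law on ι → ℝ of a vector of i.i.d. standard Gaussian coordinates, and let B : Matrix κ₁ ι ℝ and C : Matrix κ₂ ι ℝ satisfy B * Cᵀ = 0. Then the random vectors w ↦ B.mulVec w and w ↦ C.mulVec w are independent under μ (IndepFun). -/
open Matrix MeasureTheory ProbabilityTheory

/-- Two linear images of an i.i.d. standard Gaussian vector are independent as soon as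
their cross-covariance `B * Cᵀ` vanishes. -/
theorem indepFun_mulVec_of_mul_transpose_eq_zero
    {ι κ₁ κ₂ : Type*} [Fintype ι] [Fintype κ₁] [Fintype κ₂]
    [Nonempty ι] [Nonempty κ₁] [Nonempty κ₂]
    (B : Matrix κ₁ ι ℝ) (C : Matrix κ₂ ι ℝ) (h : B * Cᵀ = 0) :
    IndepFun (fun w : ι → ℝ => B.mulVec w) (fun w : ι → ℝ => C.mulVec w)
      (Measure.pi fun _ : ι => gaussianReal 0 1) := by
  classical
  set μ : Measure (ι → ℝ) := Measure.pi fun _ : ι => gaussianReal 0 1 with hμ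
  have hmap : ∀ i, μ.map (fun w : ι → ℝ => w i) = gaussianReal 0 1 := fun i =>
    (measurePreserving_eval (fun _ : ι => gaussianReal 0 1) i).map_eq
  have hg : ∀ i, HasGaussianLaw (fun w : ι → ℝ => w i) μ := fun i =>
    ⟨by rw [hmap i]; infer_instance⟩
  have hind : iIndepFun (fun i (w : ι → ℝ) => w i) μ :=
    iIndepFun_pi (μ := fun _ : ι => gaussianReal 0 1) (X := fun _ x => x)
      (fun _ => aemeasurable_id)
  have hG : HasGaussianLaw (fun w : ι → ℝ => w) μ := hind.hasGaussianLaw hg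
  have hL := hG.map (((Matrix.toLin' B).toContinuousLinearMap).prod
    ((Matrix.toLin' C).toContinuousLinearMap))
  have hcov : ∀ i j, cov[fun w : ι → ℝ => w i, fun w => w j; μ] = if i = j then 1 else 0 := by
    intro i j
    split_ifs with hij
    · subst hij
      rw [covariance_self (hg i).aemeasurable]
      have := variance_id_gaussianReal (μ := 0) (v := 1)
      rw [← hmap i, variance_map aemeasurable_id (hg i).aemeasurable] at this
      simpa [Function.comp_def] using this
    · exact (hind.indepFun hij).covariance_eq_zero (hg i).memLp_two (hg j).memLp_two
  refine HasGaussianLaw.indepFun_of_covariance_eval (X := fun k w => (B *ᵥ w) k)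
    (Y := fun k w => (C *ᵥ w) k) hL fun k l => ?_
  simp only [Matrix.mulVec, dotProduct]
  rw [covariance_fun_sum_fun_sum (fun i => (hg i).memLp_two.const_mul _)
    (fun i => (hg i).memLp_two.const_mul _)]
  simp only [covariance_const_mul_left, covariance_const_mul_right, hcov]
  have := congrFun (congrFun h k) l
  simpa [Matrix.mul_apply, mul_comm] using this
end

section
/- Let p, q be nonempty finite index types, let A : Matrix q p ℝ, let Γ : Matrix p p ℝ be symmetric (Γᵀ = Γ), and let Λ : Matrix q p ℝ satisfy the kriging equation A * Γ * Aᵀ * Λ = A * Γ. Then (Λᵀ * A) * Γ * (Λᵀ * A)ᵀ + (1 - Λᵀ * A) * Γ * (1 - Λᵀ * A)ᵀ = Γ. -/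
open Matrix

/-- If `Λ` solves the kriging equation `A * Γ * Aᵀ * Λ = A * Γ` for a symmetric `Γ`,
then the covariance of the kriging component plus the covariance of the innovation
component recovers `Γ`. -/
theorem kriging_covariance_decomposition
    {p q : Type*} [Fintype p] [Fintype q] [Nonempty p] [Nonempty q] [DecidableEq p]
    (A : Matrix q p ℝ) (Γ : Matrix p p ℝ) (hΓ : Γᵀ = Γ)
    (Λ : Matrix q p ℝ) (hΛ : A * Γ * Aᵀ * Λ = A * Γ) :
    (Λᵀ * A) * Γ * (Λᵀ * A)ᵀ + (1 - Λᵀ * A) * Γ * (1 - Λᵀ * A)ᵀ = Γ := by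
  have h1 : (Λᵀ * A) * Γ * (Λᵀ * A)ᵀ = (Λᵀ * A) * Γ := by
    have h := congrArg (fun M => Λᵀ * M) hΛ
    simpa only [Matrix.transpose_mul, Matrix.transpose_transpose, Matrix.mul_assoc] using h
  have h2 : (Λᵀ * A) * Γ * (Λᵀ * A)ᵀ = Γ * (Λᵀ * A)ᵀ := by
    have h := congrArg Matrix.transpose h1
    rw [Matrix.transpose_mul, Matrix.transpose_mul (Λᵀ * A) Γ, Matrix.transpose_transpose, hΓ,
      ← Matrix.mul_assoc] at h
    exact h
  generalize Λᵀ * A = P at h1 h2 ⊢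
  have h3 : (1 - P) * Γ * (1 - P)ᵀ = Γ - P * Γ - Γ * Pᵀ + P * Γ * Pᵀ := by
    rw [Matrix.transpose_sub, Matrix.transpose_one]
    noncomm_ring
  rw [h3, ← h2, h1]
  abel
end

section
/- Let p, q, ι be nonempty finite index types, let μ = Measure.pi (fun _ : ι => gaussianReal 0 1) be the law on ι → ℝ of a vector of i.i.d. standard Gaussian coordinates, let A : Matrix q p ℝ, T : Matrix p ι ℝ, set Γ = T * Tᵀ, and let Λ : Matrix q p ℝ satisfy A * Γ * Aᵀ * Λ = A * Γ. Then the pushforward of the product measure μ.prod μ under the map (w, w') ↦ (Λᵀ * A * T).mulVec w + ((1 - Λᵀ * A) * T).mulVec w' equals the pushforward of μ under the map w ↦ T.mulVec w, as measures on p → ℝ. -/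
open Matrix MeasureTheory ProbabilityTheory

/-- Pushing forward the standard Gaussian by `v ↦ c ⬝ᵥ v`, characteristic function. -/
lemma charFunDual_stdGaussian_pi {ι : Type*} [Fintype ι] (L : StrongDual ℝ (ι → ℝ)) (c : ι → ℝ)
    (hL : ∀ v, L v = c ⬝ᵥ v) :
    charFunDual (Measure.pi fun _ : ι => gaussianReal 0 1) L
      = Complex.exp (-(((c ⬝ᵥ c : ℝ) : ℂ) / 2)) := by
  classical
  have h1 : charFunDual (Measure.pi fun _ : ι => gaussianReal 0 1) L
      = ∏ i, ∫ x, Complex.exp (c i * x * Complex.I) ∂(gaussianReal 0 1) := by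
    rw [charFunDual_apply, ← integral_fintype_prod_eq_prod]
    congr 1
    ext v
    rw [hL, ← Complex.exp_sum, ← Finset.sum_mul]
    simp [dotProduct]
  rw [h1]
  simp_rw [← charFun_apply_real, charFun_gaussianReal]
  rw [← Complex.exp_sum]
  congr 1
  simp [dotProduct, Finset.sum_div, pow_two]

/-- The kriging equation makes the two covariances add up to `Γ`. -/
lemma kriging_cov {p q ι : Type*} [Fintype p] [Fintype q] [Fintype ι] [DecidableEq p]
    (A : Matrix q p ℝ) (T : Matrix p ι ℝ) (Λ : Matrix q p ℝ)
    (hΛ : A * (T * Tᵀ) * Aᵀ * Λ = A * (T * Tᵀ)) :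
    (Λᵀ * A * T) * (Λᵀ * A * T)ᵀ + ((1 - Λᵀ * A) * T) * ((1 - Λᵀ * A) * T)ᵀ = T * Tᵀ := by
  have h2 : Λᵀ * A * (T * Tᵀ) * (Λᵀ * A)ᵀ = Λᵀ * A * (T * Tᵀ) := by
    rw [transpose_mul, transpose_transpose]
    simp only [Matrix.mul_assoc] at hΛ ⊢
    rw [hΛ]
  have h3 : Λᵀ * A * (T * Tᵀ) * (Λᵀ * A)ᵀ = (T * Tᵀ) * (Λᵀ * A)ᵀ := by
    have := congrArg transpose h2
    simpa only [transpose_mul, transpose_transpose, Matrix.mul_assoc] using this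
  generalize Λᵀ * A = B at *
  have e1 : (B * T) * (B * T)ᵀ = B * (T * Tᵀ) * Bᵀ := by
    simp only [transpose_mul, Matrix.mul_assoc]
  have e2 : ((1 - B) * T) * ((1 - B) * T)ᵀ = (1 - B) * (T * Tᵀ) * (1 - B)ᵀ := by
    simp only [transpose_mul, Matrix.mul_assoc]
  rw [e1, e2, transpose_sub, transpose_one]
  simp only [Matrix.sub_mul, Matrix.mul_sub, Matrix.one_mul, Matrix.mul_one]
  rw [← h3, h2]
  abel



/-- Distributional exactness of the conditional super-resolution sampler: if `Λ` solves
the kriging equation for `Γ = T * Tᵀ`, then the sum of the kriging component computed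
from one Gaussian sample and the innovation component computed from an independent
sample has exactly the law of `T w`. -/
theorem sampler_law_eq_model_law
    {p q ι : Type*} [Fintype p] [Fintype q] [Fintype ι]
    [Nonempty p] [Nonempty q] [Nonempty ι] [DecidableEq p]
    (A : Matrix q p ℝ) (T : Matrix p ι ℝ) (Γ : Matrix p p ℝ) (hΓ : Γ = T * Tᵀ)
    (Λ : Matrix q p ℝ) (hΛ : A * Γ * Aᵀ * Λ = A * Γ) :
    Measure.map
      (fun ww : (ι → ℝ) × (ι → ℝ) =>
        (Λᵀ * A * T).mulVec ww.1 + ((1 - Λᵀ * A) * T).mulVec ww.2)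
      ((Measure.pi fun _ : ι => gaussianReal 0 1).prod
        (Measure.pi fun _ : ι => gaussianReal 0 1))
      = Measure.map (fun w : ι → ℝ => T.mulVec w)
          (Measure.pi fun _ : ι => gaussianReal 0 1) := by

  subst hΓ
  have hcov := kriging_cov A T Λ hΛ
  generalize Λᵀ * A * T = M at *
  generalize (1 - Λᵀ * A) * T = N at *
  have hdot : ∀ (K : Matrix p ι ℝ) (a : p → ℝ),
      (a ᵥ* K) ⬝ᵥ (a ᵥ* K) = a ⬝ᵥ ((K * Kᵀ) *ᵥ a) := by
    intro K a
    rw [← Matrix.mulVec_mulVec, Matrix.mulVec_transpose, Matrix.dotProduct_mulVec]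
  let Φ (K : Matrix p ι ℝ) : (ι → ℝ) →L[ℝ] (p → ℝ) := K.mulVecLin.toContinuousLinearMap
  have hΦ : ∀ K v, Φ K v = K *ᵥ v := fun K v => rfl
  let Ψ : ((ι → ℝ) × (ι → ℝ)) →L[ℝ] (p → ℝ) := (Φ M).coprod (Φ N)
  change Measure.map Ψ _ = Measure.map (Φ T) _
  have : IsProbabilityMeasure (Measure.map Ψ ((Measure.pi fun _ : ι => gaussianReal 0 1).prod
        (Measure.pi fun _ : ι => gaussianReal 0 1))) :=
    Measure.isProbabilityMeasure_map (by fun_prop)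
  have : IsProbabilityMeasure (Measure.map (Φ T) (Measure.pi fun _ : ι => gaussianReal 0 1)) :=
    Measure.isProbabilityMeasure_map (by fun_prop)
  apply Measure.ext_of_charFunDual
  ext L
  let a : p → ℝ := fun i => L (Pi.single i 1)
  have hL : ∀ v, L v = a ⬝ᵥ v := by
    intro v
    conv_lhs => rw [pi_eq_sum_univ' v, map_sum]
    simp [a, dotProduct, mul_comm]
  rw [charFunDual_map, charFunDual_map, charFunDual_prod,
    charFunDual_stdGaussian_pi _ (a ᵥ* M) (fun v => by
      simp [Ψ, hΦ, hL, Matrix.dotProduct_mulVec]),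
    charFunDual_stdGaussian_pi _ (a ᵥ* N) (fun v => by
      simp [Ψ, hΦ, hL, Matrix.dotProduct_mulVec]),
    charFunDual_stdGaussian_pi _ (a ᵥ* T) (fun v => by
      simp [hΦ, hL, Matrix.dotProduct_mulVec]),
    ← Complex.exp_add, hdot, hdot, hdot, ← hcov, Matrix.add_mulVec, dotProduct_add]
  congr 1
  push_cast
  ring
end

section
/- Fix positive integers r, m, n and set M = r·m, N = r·n. Let ι : ZMod m × ZMod n → ZMod M × ZMod N be the injective additive group homomorphism sending (1,0) to (r,0) and (0,1) to (0,r), and let S be the (ZMod m × ZMod n) × (ZMod M × ZMod N) real matrix with S(x, z) = 1 if z = ι(x) and 0 otherwise. For any kernel β : ZMod m × ZMod n → ℝ, one has Sᵀ * C'_β = C_{Sᵀ.mulVec β} * Sᵀ, where C'_β is the coarse-grid convolution matrix of β (on ZMod m × ZMod n) and C_{Sᵀ.mulVec β} is the fine-grid convolution matrix (on ZMod M × ZMod N) of the zero-padded kernel Sᵀ.mulVec β. -/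
open Matrix

/-- Periodic convolution on a finite abelian group. -/
noncomputable def conv {G : Type*} [AddCommGroup G] [Fintype G] (u v : G → ℝ) : G → ℝ :=
  fun x => ∑ y, u (x - y) * v y

/-- The convolution matrix `C_u` with entries `C_u(x, y) = u (x - y)`. -/
noncomputable def convMat {G : Type*} [AddCommGroup G] [Fintype G] (u : G → ℝ) :
    Matrix G G ℝ :=
  Matrix.of fun x y => u (x - y)

/-- The subsampling matrix associated with an embedding `ι` of the coarse grid in the
fine grid: `S(x, z) = 1` if `z = ι x` and `0` otherwise. -/
noncomputable def sampMat {H G : Type*} [Fintype H] [Fintype G] [DecidableEq G]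
    (ι : H → G) : Matrix H G ℝ :=
  Matrix.of fun x z => if z = ι x then 1 else 0

/-- Zero-padding intertwines coarse- and fine-grid convolutions:
`Sᵀ * C'_β = C_{Sᵀ.mulVec β} * Sᵀ`. -/
theorem transpose_sampMat_mul_convMat (r m n : ℕ) [NeZero r] [NeZero m] [NeZero n]
    (ι : (ZMod m × ZMod n) →+ ZMod (r * m) × ZMod (r * n))
    (hinj : Function.Injective ι)
    (h10 : ι (1, 0) = ((r : ZMod (r * m)), 0))
    (h01 : ι (0, 1) = (0, (r : ZMod (r * n))))
    (β : ZMod m × ZMod n → ℝ) :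
    (sampMat ι)ᵀ * convMat β = convMat ((sampMat ι)ᵀ.mulVec β) * (sampMat ι)ᵀ := by
  ext z y
  have hL : ((sampMat ι)ᵀ * convMat β) z y = ∑ x, (if z = ι x then β (x - y) else 0) := by
    simp [Matrix.mul_apply, sampMat, convMat]
  have hR : (convMat ((sampMat ι)ᵀ.mulVec β) * (sampMat ι)ᵀ) z y
      = ∑ x, (if z - ι y = ι x then β x else 0) := by
    simp [Matrix.mul_apply, sampMat, convMat, Matrix.mulVec, dotProduct]
  rw [hL, hR]
  refine Fintype.sum_equiv (Equiv.subRight y) _ _ fun x => ?_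
  simp [map_sub]
end

section
/- Fix positive integers r, m, n and set M = r·m, N = r·n, with S the subsampling matrix associated with the lattice embedding ι : ZMod m × ZMod n → ZMod M × ZMod N sending (1,0) to (r,0) and (0,1) to (0,r). Let c, t : ZMod M × ZMod N → ℝ, let A = S * C_c be the zoom-out operator and Γ = C_{t ⋆ ť} the covariance matrix of the ADSN model with texton t (where ť(x) = t(−x)). Then A * Γ * Aᵀ = C'_κ, where κ = S.mulVec (t ⋆ ť ⋆ c ⋆ č) : ZMod m × ZMod n → ℝ and C'_κ is the coarse-grid convolution matrix of κ. -/
open Matrix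

theorem aux_convMat_mul {G : Type*} [AddCommGroup G] [Fintype G] (u v : G → ℝ) :
    convMat u * convMat v = convMat (conv u v) := by
  ext x z
  simp only [Matrix.mul_apply, convMat, conv, Matrix.of_apply]
  refine Fintype.sum_equiv (Equiv.subRight z) _ _ fun y => ?_
  simp

theorem aux_conv_comm {G : Type*} [AddCommGroup G] [Fintype G] (u v : G → ℝ) :
    conv u v = conv v u := by
  ext x
  simp only [conv]
  refine Fintype.sum_equiv (Equiv.subLeft x) _ _ fun y => ?_
  simp [mul_comm]

theorem aux_convMat_transpose {G : Type*} [AddCommGroup G] [Fintype G] (u : G → ℝ) :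
    (convMat u)ᵀ = convMat (fun x => u (-x)) := by
  ext x y
  simp [convMat]

theorem aux_samp {H G : Type*} [AddCommGroup H] [Fintype H] [AddCommGroup G] [Fintype G]
    [DecidableEq G] (ι : H →+ G) (w : G → ℝ) :
    sampMat ι * convMat w * (sampMat ι)ᵀ = convMat ((sampMat ι).mulVec w) := by
  ext x y
  simp [sampMat, convMat, Matrix.mul_apply, Matrix.mulVec, dotProduct]

/-- For the zoom-out operator `A = S * C_c` and the ADSN covariance `Γ = C_{t ⋆ ť}`,
`A * Γ * Aᵀ` is the coarse-grid convolution by `κ = S (t ⋆ ť ⋆ c ⋆ č)`. -/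
theorem zoomOut_covariance_zoomOut_transpose_eq_convMat
    (r m n : ℕ) [NeZero r] [NeZero m] [NeZero n]
    (ι : (ZMod m × ZMod n) →+ ZMod (r * m) × ZMod (r * n))
    (hinj : Function.Injective ι)
    (h10 : ι (1, 0) = ((r : ZMod (r * m)), 0))
    (h01 : ι (0, 1) = (0, (r : ZMod (r * n))))
    (c t : ZMod (r * m) × ZMod (r * n) → ℝ) :
    (sampMat ι * convMat c) * convMat (conv t (fun x => t (-x)))
        * (sampMat ι * convMat c)ᵀ
      = convMat ((sampMat ι).mulVec
          (conv (conv (conv t (fun x => t (-x))) c) (fun x => c (-x)))) := by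
  rw [Matrix.transpose_mul, aux_convMat_transpose, ← aux_samp, aux_conv_comm _ c]
  simp only [← aux_convMat_mul, Matrix.mul_assoc]
end

section
/- Let ι, q be nonempty finite index types, let C : Matrix ι ι ℝ, A : Matrix q ι ℝ, set Γ = C * Cᵀ, and let P : Matrix q q ℝ be a Moore–Penrose pseudoinverse of A * Γ * Aᵀ. Then for every w : ι → ℝ, ‖(Γ * Aᵀ * P * A * C).mulVec w‖₂ ≤ ‖C‖₂ · ‖w‖₂, where ‖x‖₂ = √(∑ i, (x i)²) is the Euclidean norm and ‖C‖₂ is the ℓ²-operator norm of C (the least K ≥ 0 with ‖C.mulVec x‖₂ ≤ K·‖x‖₂ for all x). -/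
open Matrix

/-- The Euclidean norm `‖x‖₂ = √(∑ i, (x i)²)`. -/
noncomputable def euclNorm {n : Type*} [Fintype n] (x : n → ℝ) : ℝ :=
  Real.sqrt (∑ i, (x i) ^ 2)

/-- Stability of the kriging operator on the subspace of low-resolution ADSN samples:
with `Γ = C * Cᵀ` and `P` a Moore–Penrose pseudoinverse of `A * Γ * Aᵀ`, applying the
kriging operator `Γ Aᵀ P` to the low-resolution measurement `A C w` is bounded by
`‖C‖₂ ‖w‖₂`, where `‖C‖₂` is the least `K ≥ 0` with `‖C x‖₂ ≤ K ‖x‖₂` for all `x`. -/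
theorem kriging_stability
    {ι q : Type*} [Fintype ι] [Fintype q] [Nonempty ι] [Nonempty q]
    (C : Matrix ι ι ℝ) (A : Matrix q ι ℝ) (Γ : Matrix ι ι ℝ) (hΓ : Γ = C * Cᵀ)
    (P : Matrix q q ℝ)
    (h1 : (A * Γ * Aᵀ) * P * (A * Γ * Aᵀ) = A * Γ * Aᵀ)
    (h2 : P * (A * Γ * Aᵀ) * P = P)
    (h3 : ((A * Γ * Aᵀ) * P)ᵀ = (A * Γ * Aᵀ) * P)
    (h4 : (P * (A * Γ * Aᵀ))ᵀ = P * (A * Γ * Aᵀ))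
    (K : ℝ)
    (hK : IsLeast {K : ℝ | 0 ≤ K ∧ ∀ x : ι → ℝ, euclNorm (C.mulVec x) ≤ K * euclNorm x} K)
    (w : ι → ℝ) :
    euclNorm ((Γ * Aᵀ * P * A * C).mulVec w) ≤ K * euclNorm w := by
  obtain ⟨hK0, hKC⟩ := hK.1
  subst hΓ
  obtain ⟨M, hM⟩ : ∃ M : Matrix q ι ℝ, M = A * C := ⟨_, rfl⟩
  have hB : A * (C * Cᵀ) * Aᵀ = M * Mᵀ := by
    rw [hM, Matrix.transpose_mul]; simp only [Matrix.mul_assoc]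
  rw [hB] at h1
  have hBM : M * Mᵀ * P * M = M := by
    have hD : (M * Mᵀ * P * M - M) * Mᵀ = 0 := by
      rw [Matrix.sub_mul, Matrix.mul_assoc (M * Mᵀ * P), h1, sub_self]
    have hDD : (M * Mᵀ * P * M - M) * (M * Mᵀ * P * M - M)ᴴ = 0 := by
      rw [Matrix.conjTranspose_eq_transpose_of_trivial]
      conv_lhs => rw [Matrix.transpose_sub, Matrix.transpose_mul _ M]
      rw [Matrix.mul_sub, ← Matrix.mul_assoc, hD, Matrix.zero_mul, sub_zero]
    exact sub_eq_zero.mp (Matrix.self_mul_conjTranspose_eq_zero.mp hDD)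
  obtain ⟨Q, hQ⟩ : ∃ Q : Matrix ι ι ℝ, Q = Mᵀ * P * M := ⟨_, rfl⟩
  have hQQ : Qᵀ * Q = Qᵀ := by
    have e : M * Q = M := by rw [hQ, ← Matrix.mul_assoc, ← Matrix.mul_assoc, hBM]
    conv_lhs => rw [hQ, Matrix.transpose_mul, Matrix.transpose_mul, Matrix.transpose_transpose,
      ← hQ]
    rw [hQ, Matrix.transpose_mul, Matrix.transpose_mul, Matrix.transpose_transpose, ← hQ]
    simp only [Matrix.mul_assoc, e]
  have hCQ : C * Cᵀ * Aᵀ * P * A * C = C * Q := by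
    rw [hQ, hM, Matrix.transpose_mul]; simp only [Matrix.mul_assoc]
  rw [hCQ, ← Matrix.mulVec_mulVec]
  refine (hKC _).trans (mul_le_mul_of_nonneg_left ?_ hK0)
  have hdot : (Q *ᵥ w) ⬝ᵥ (Q *ᵥ w) = w ⬝ᵥ (Q *ᵥ w) := by
    have e1 : (Q *ᵥ w) ⬝ᵥ (Q *ᵥ w) = (Qᵀ *ᵥ (Q *ᵥ w)) ⬝ᵥ w := by
      rw [Matrix.dotProduct_mulVec, Matrix.mulVec_transpose]
    rw [e1, Matrix.mulVec_mulVec, hQQ, Matrix.mulVec_transpose, ← Matrix.dotProduct_mulVec,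
      dotProduct_comm]
    try rw [dotProduct_comm]
  unfold euclNorm
  apply Real.sqrt_le_sqrt
  have h0 : 0 ≤ ∑ i, (w i - (Q *ᵥ w) i) ^ 2 := Finset.sum_nonneg fun i _ => sq_nonneg _
  have h5 : ∑ i, (w i - (Q *ᵥ w) i) ^ 2
      = ∑ i, (w i) ^ 2 - 2 * (w ⬝ᵥ (Q *ᵥ w)) + (Q *ᵥ w) ⬝ᵥ (Q *ᵥ w) := by
    simp only [dotProduct, Finset.mul_sum, ← Finset.sum_sub_distrib, ← Finset.sum_add_distrib]
    exact Finset.sum_congr rfl fun i _ => by ring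
  have h6 : ∑ i, ((Q *ᵥ w) i) ^ 2 = (Q *ᵥ w) ⬝ᵥ (Q *ᵥ w) := by
    simp only [dotProduct, pow_two]
  linarith
end

section
/- Let p, q, ι be nonempty finite index types, let μ = Measure.pi (fun _ : ι => gaussianReal 0 1) be the law on ι → ℝ of a vector of i.i.d. standard Gaussian coordinates, let u : p → ℝ, v : q → ℝ, A : Matrix q p ℝ, Λ : Matrix q p ℝ, T : Matrix p ι ℝ, and set Γ = T * Tᵀ. Then ∫ ‖u - (Λᵀ.mulVec v + ((1 - Λᵀ * A) * T).mulVec w)‖₂² dμ(w) = ‖u - Λᵀ.mulVec v‖₂² + trace((1 - Λᵀ * A) * Γ * (1 - Λᵀ * A)ᵀ), and in particular ∫ ‖u - (Λᵀ.mulVec v + ((1 - Λᵀ * A) * T).mulVec w)‖₂² dμ(w) ≥ ‖u - Λᵀ.mulVec v‖₂², where ‖x‖₂ = √(∑ i, (x i)²) is the Euclidean norm. -/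
open Matrix MeasureTheory ProbabilityTheory

theorem row_moment {ι : Type*} [Fintype ι] (c : ℝ) (m : ι → ℝ) :
    Integrable (fun w : ι → ℝ => (c - ∑ i, m i * w i) ^ 2)
      (Measure.pi fun _ : ι => gaussianReal 0 1) ∧
    ∫ w, (c - ∑ i, m i * w i) ^ 2 ∂(Measure.pi fun _ : ι => gaussianReal 0 1)
      = c ^ 2 + ∑ i, m i ^ 2 := by
  have hL0 : ∀ i, MemLp (fun x : ℝ => m i * x) 2 (gaussianReal 0 1) := fun i =>
    (memLp_id_gaussianReal' 2 (by simp)).const_mul (m i)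
  have hLi : ∀ i, MemLp (fun w : ι → ℝ => m i * w i) 2
      (Measure.pi fun _ : ι => gaussianReal 0 1) := fun i =>
    (hL0 i).comp_measurePreserving (measurePreserving_eval (fun _ : ι => gaussianReal 0 1) i)
  have hL : MemLp (fun w : ι → ℝ => ∑ i, m i * w i) 2
      (Measure.pi fun _ : ι => gaussianReal 0 1) := memLp_finsetSum _ fun i _ => hLi i
  have hint := hL.integrable (by norm_num)
  have hmean : ∫ w, (∑ i, m i * w i) ∂(Measure.pi fun _ : ι => gaussianReal 0 1) = 0 := by
    rw [integral_finsetSum _ fun i _ => (hLi i).integrable (by norm_num)]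
    refine Finset.sum_eq_zero fun i _ => ?_
    rw [integral_const_mul]
    have h := integral_comp_eval (μ := fun _ : ι => gaussianReal 0 1) (i := i)
      (f := fun x : ℝ => x) (by fun_prop)
    rw [h, integral_id_gaussianReal, mul_zero]
  have hvar := variance_sum_pi (μ := fun _ : ι => gaussianReal 0 1)
    (X := fun i (x : ℝ) => m i * x) hL0
  have hfun : (∑ i, fun w : ι → ℝ => m i * w i) = fun w : ι → ℝ => ∑ i, m i * w i := by
    ext w; simp
  rw [hfun, variance_of_integral_eq_zero hL.aestronglyMeasurable.aemeasurable hmean] at hvar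
  have hv : ∀ i, variance (fun x : ℝ => m i * x) (gaussianReal 0 1) = m i ^ 2 := fun i => by
    rw [variance_const_mul (m i) (fun x : ℝ => x), variance_fun_id_gaussianReal]
    simp
  simp only [hv] at hvar
  have hsq := hL.integrable_sq
  have hexp : (fun w : ι → ℝ => (c - ∑ i, m i * w i) ^ 2)
      = fun w => (c ^ 2 - (2 * c) * ∑ i, m i * w i) + (∑ i, m i * w i) ^ 2 := by
    ext w; ring
  have h1 : Integrable (fun w : ι → ℝ => c ^ 2 - (2 * c) * ∑ i, m i * w i)
      (Measure.pi fun _ : ι => gaussianReal 0 1) :=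
    (integrable_const (c ^ 2)).sub (hint.const_mul (2 * c))
  rw [hexp]
  refine ⟨h1.add hsq, ?_⟩
  rw [integral_add h1 hsq, hvar, integral_sub (integrable_const _) (hint.const_mul _),
    integral_const_mul, hmean]
  simp

/-- The expected mean-square error between a HR image `u` and the stochastic SR samples
`Λᵀ v + (1 − Λᵀ A) T w` equals the deterministic error of the kriging component plus
the trace of the innovation covariance; in particular it is at least the MSE of the
kriging component. -/
theorem expected_mse_decomposition
    {p q ι : Type*} [Fintype p] [Fintype q] [Fintype ι]
    [Nonempty p] [Nonempty q] [Nonempty ι] [DecidableEq p]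
    (u : p → ℝ) (v : q → ℝ) (A Λ : Matrix q p ℝ) (T : Matrix p ι ℝ)
    (Γ : Matrix p p ℝ) (hΓ : Γ = T * Tᵀ) :
    (∫ w, (euclNorm (u - (Λᵀ.mulVec v + ((1 - Λᵀ * A) * T).mulVec w))) ^ 2
        ∂(Measure.pi fun _ : ι => gaussianReal 0 1)
      = (euclNorm (u - Λᵀ.mulVec v)) ^ 2
        + ((1 - Λᵀ * A) * Γ * (1 - Λᵀ * A)ᵀ).trace) ∧
    (euclNorm (u - Λᵀ.mulVec v)) ^ 2
      ≤ ∫ w, (euclNorm (u - (Λᵀ.mulVec v + ((1 - Λᵀ * A) * T).mulVec w))) ^ 2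
          ∂(Measure.pi fun _ : ι => gaussianReal 0 1) := by
  have key : ∫ w, (euclNorm (u - (Λᵀ.mulVec v + ((1 - Λᵀ * A) * T).mulVec w))) ^ 2
        ∂(Measure.pi fun _ : ι => gaussianReal 0 1)
      = (euclNorm (u - Λᵀ.mulVec v)) ^ 2
        + ∑ k, ∑ i, (((1 - Λᵀ * A) * T : Matrix p ι ℝ) k i) ^ 2 := by
    have hsq : ∀ x : p → ℝ, euclNorm x ^ 2 = ∑ k, x k ^ 2 := fun x =>
      Real.sq_sqrt (Finset.sum_nonneg fun k _ => sq_nonneg _)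
    simp only [hsq]
    generalize (1 - Λᵀ * A) * T = M
    generalize Λᵀ.mulVec v = b
    have hf : ∀ w : ι → ℝ, ∑ k, (u - (b + M.mulVec w)) k ^ 2
        = ∑ k, ((u - b) k - ∑ i, M k i * w i) ^ 2 := fun w => by
      refine Finset.sum_congr rfl fun k _ => ?_
      simp only [Pi.sub_apply, Pi.add_apply, Matrix.mulVec, dotProduct]
      ring
    simp only [hf]
    rw [integral_finsetSum _ fun k _ => (row_moment ((u - b) k) (fun i => M k i)).1, ← Finset.sum_add_distrib]
    exact Finset.sum_congr rfl fun k _ => row_moment ((u - b) k) (fun i => M k i) |>.2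
  have htr : ((1 - Λᵀ * A) * Γ * (1 - Λᵀ * A)ᵀ).trace
      = ∑ k, ∑ i, (((1 - Λᵀ * A) * T : Matrix p ι ℝ) k i) ^ 2 := by
    have : (1 - Λᵀ * A) * Γ * (1 - Λᵀ * A)ᵀ
        = ((1 - Λᵀ * A) * T) * ((1 - Λᵀ * A) * T)ᵀ := by
      rw [hΓ, Matrix.transpose_mul]; simp only [Matrix.mul_assoc]
    rw [this]
    generalize (1 - Λᵀ * A) * T = M
    simp only [Matrix.trace, Matrix.diag, Matrix.mul_apply, Matrix.transpose_apply, sq]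
  refine ⟨by rw [key, htr], ?_⟩
  rw [key]
  exact le_add_of_nonneg_right
    (Finset.sum_nonneg fun k _ => Finset.sum_nonneg fun i _ => sq_nonneg _)
end

section
/- Fix positive integers r, m, n, set M = r·m, N = r·n, G = ZMod M × ZMod N, and let ι : ZMod m × ZMod n → G be the injective additive group homomorphism sending (1,0) to (r,0) and (0,1) to (0,r), with S the associated subsampling matrix (S(x, z) = 1 if z = ι(x), else 0). Let t, c : G → ℝ and η : ZMod m × ZMod n → ℝ, let μ = Measure.pi (fun _ : G => gaussianReal 0 1) be the law on G → ℝ of i.i.d. standard Gaussian pixels, and define the innovation map Y : (G → ℝ) → (G → ℝ) by Y w = (t ⋆ w) - ((C_{Sᵀ.mulVec η}).mulVec ((Sᵀ * S * C_c).mulVec (t ⋆ w))), i.e. the innovation component X̃ − Λᵀ A X̃ with X̃ = t ⋆ w, A = S * C_c and Λᵀ = C'_η composed with Sᵀ. Then for every z in the range of ι, the pushforward measure Measure.map (fun w => fun x => Y w (x - z)) μ equals Measure.map Y μ; that is, the law of the innovation component is invariant under all translations by vectors of the sublattice ι(ZMod m × ZMod n) = { (r·k, r·ℓ) }. -/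
open Matrix MeasureTheory ProbabilityTheory

theorem conv_shift {G : Type*} [AddCommGroup G] [Fintype G] (u v : G → ℝ) (z : G) :
    conv u (fun x => v (x - z)) = fun x => conv u v (x - z) := by
  funext x
  unfold conv
  refine Fintype.sum_equiv (Equiv.subRight z) _ _ fun y => ?_
  simp

theorem convMat_mulVec_eq {G : Type*} [AddCommGroup G] [Fintype G] (u v : G → ℝ) :
    (convMat u).mulVec v = conv u v := by
  funext x
  simp [convMat, conv, Matrix.mulVec, dotProduct]

theorem samp_shift {H G : Type*} [AddCommGroup H] [Fintype H] [AddCommGroup G] [Fintype G]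
    [DecidableEq G] (ι : H →+ G) (v : G → ℝ) (k : H) :
    (sampMat ι)ᵀ.mulVec ((sampMat ι).mulVec (fun x => v (x - ι k))) =
      fun x => (sampMat ι)ᵀ.mulVec ((sampMat ι).mulVec v) (x - ι k) := by
  funext x
  simp only [sampMat, Matrix.mulVec, dotProduct, Matrix.transpose_apply, Matrix.of_apply,
    ite_mul, one_mul, zero_mul, Finset.sum_ite_eq', Finset.sum_ite_eq, Finset.mem_univ, if_true]
  refine Fintype.sum_equiv (Equiv.subRight k) _ _ fun y => ?_
  simp

theorem map_shift_pi {G : Type*} [AddCommGroup G] [Fintype G] (ν : Measure ℝ)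
    [SigmaFinite ν] (z : G) :
    MeasurePreserving (fun (w : G → ℝ) (x : G) => w (x - z))
      (Measure.pi fun _ : G => ν) (Measure.pi fun _ : G => ν) := by
  have h := measurePreserving_piCongrLeft (α := fun _ : G => ℝ) (fun _ : G => ν)
    (Equiv.addRight z)
  convert h using 1
  funext w x
  have := MeasurableEquiv.piCongrLeft_apply_apply (β := fun _ : G => ℝ) (Equiv.addRight z) w (x - z)
  simpa using this.symm

/-- Cyclostationarity of the innovation component: with `X̃ = t ⋆ w` an ADSN sample,
`A = S * C_c` the zoom-out operator and `Λᵀ = C_{Sᵀ η} ∘ Sᵀ` the (convolution-form)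
kriging operator, the law of the innovation component `X̃ − Λᵀ A X̃` is invariant under
every translation by a vector of the sublattice `ι (ZMod m × ZMod n)`. -/
theorem innovation_law_translation_invariant
    (r m n : ℕ) [NeZero r] [NeZero m] [NeZero n]
    (ι : (ZMod m × ZMod n) →+ ZMod (r * m) × ZMod (r * n))
    (hinj : Function.Injective ι)
    (h10 : ι (1, 0) = ((r : ZMod (r * m)), 0))
    (h01 : ι (0, 1) = (0, (r : ZMod (r * n))))
    (t c : ZMod (r * m) × ZMod (r * n) → ℝ)
    (η : ZMod m × ZMod n → ℝ) :
    ∀ z ∈ Set.range ι,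
      Measure.map
        (fun (w : ZMod (r * m) × ZMod (r * n) → ℝ)
            (x : ZMod (r * m) × ZMod (r * n)) =>
          (conv t w - (convMat ((sampMat ι)ᵀ.mulVec η)).mulVec
            (((sampMat ι)ᵀ * sampMat ι * convMat c).mulVec (conv t w))) (x - z))
        (Measure.pi fun _ : ZMod (r * m) × ZMod (r * n) => gaussianReal 0 1)
      = Measure.map
          (fun w : ZMod (r * m) × ZMod (r * n) → ℝ =>
            conv t w - (convMat ((sampMat ι)ᵀ.mulVec η)).mulVec
              (((sampMat ι)ᵀ * sampMat ι * convMat c).mulVec (conv t w)))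
          (Measure.pi fun _ : ZMod (r * m) × ZMod (r * n) => gaussianReal 0 1) := by
  rintro z ⟨k, rfl⟩
  have hcomm : ∀ (w : ZMod (r * m) × ZMod (r * n) → ℝ),
      conv t (fun x => w (x - ι k)) - (convMat ((sampMat ι)ᵀ.mulVec η)).mulVec
        (((sampMat ι)ᵀ * sampMat ι * convMat c).mulVec (conv t (fun x => w (x - ι k)))) =
      fun x => (conv t w - (convMat ((sampMat ι)ᵀ.mulVec η)).mulVec
        (((sampMat ι)ᵀ * sampMat ι * convMat c).mulVec (conv t w))) (x - ι k) := by
    intro w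
    simp only [← Matrix.mulVec_mulVec, convMat_mulVec_eq, conv_shift, samp_shift]
    rfl
  have hmeas : Measurable (fun w : ZMod (r * m) × ZMod (r * n) → ℝ =>
      conv t w - (convMat ((sampMat ι)ᵀ.mulVec η)).mulVec
        (((sampMat ι)ᵀ * sampMat ι * convMat c).mulVec (conv t w))) := by
    apply Continuous.measurable
    have hc : Continuous (fun w : ZMod (r * m) × ZMod (r * n) → ℝ => conv t w) := by
      unfold conv
      fun_prop
    exact hc.sub (continuous_const.matrix_mulVec (continuous_const.matrix_mulVec hc))
  have hp := map_shift_pi (gaussianReal 0 1) (ι k)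
  conv_rhs => rw [← hp.map_eq]
  rw [Measure.map_map hmeas hp.measurable]
  congr 1
  funext w
  exact (hcomm w).symm
end
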